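/- Let p and n be integers with p ≤ n ≤ 2p−5 and set φ := n − p. For every x with 2φ ≤ x ≤ n−1, x ≥ 1, and every integer y ≥ 0, the element G_{n−1}^y · G_x · G_{n−1}^{−y} lies in the subgroup L_{x+y} of H_n. -/

import Mathlib

/-- Right-angled Artin relations on `N` generators (indexed `0, …, N-1`, standing for
`h_1, …, h_N`): commutators of generators whose indices differ by more than one. -/
def RaagRels (N : ℕ) : Set (FreeGroup (Fin N)) :=
  {rel | ∃ i j : Fin N, (i : ℕ) + 1 < (j : ℕ) ∧
    rel = FreeGroup.of i * FreeGroup.of j * (FreeGroup.of i)⁻¹ * (FreeGroup.of j)⁻¹}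

/-- The right-angled Artin group `H_n` on generators `h_1, …, h_{n-1}` subject to
`h_i h_j = h_j h_i` whenever `|i - j| > 1`. -/
abbrev Hgrp (n : ℕ) := PresentedGroup (RaagRels (n - 1))

/-- The generator `h_i` of `H_n`, for `1 ≤ i ≤ n-1` (and `1` for out-of-range indices). -/
def hgen (n : ℕ) (i : ℕ) : Hgrp n :=
  if h : 1 ≤ i ∧ i ≤ n - 1 then PresentedGroup.of (⟨i - 1, by omega⟩ : Fin (n - 1)) else 1

/-- `A(a,b) := h_a h_{a+1} ⋯ h_b` (the identity when `a > b`). -/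
def Aprod (n a b : ℕ) : Hgrp n := ((List.range' a (b + 1 - a) 1).map (hgen n)).prod

/-- `E(a,b) := h_a h_{a+2} ⋯ h_b` for even `a, b` (the identity when `a > b`). -/
def Eprod (n a b : ℕ) : Hgrp n := ((List.range' a ((b + 2 - a) / 2) 2).map (hgen n)).prod

/-- `O(a,b) := h_a h_{a+2} ⋯ h_b` for odd `a, b` (the identity when `a > b`). -/
def Oprod (n a b : ℕ) : Hgrp n := ((List.range' a ((b + 2 - a) / 2) 2).map (hgen n)).prod

/-- The elements `G_i` of `H_n` (with `φ := n - p`): `G_1 := h_1`,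
`G_{2k} := O(3,2k-1)·E(2,2k)` and `G_{2k+1} := O(3,2k+1)·E(2,2k)` for `1 ≤ k ≤ φ`, and
`G_i := O(3,2φ+1)·E(2,2φ)·A(2φ+2,i)` for `2φ+2 ≤ i ≤ n-1`. -/
def Ggen (n p i : ℕ) : Hgrp n :=
  if i = 1 then hgen n 1
  else if i ≤ 2 * (n - p) + 1 then
    if i % 2 = 0 then Oprod n 3 (i - 1) * Eprod n 2 i
    else Oprod n 3 i * Eprod n 2 (i - 1)
  else Oprod n 3 (2 * (n - p) + 1) * Eprod n 2 (2 * (n - p)) * Aprod n (2 * (n - p) + 2) i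

/-- `L_m`: the subgroup of `H_n` generated by the `h_i` with `1 ≤ i ≤ min m (n-1)`. -/
def Lsub (n m : ℕ) : Subgroup (Hgrp n) :=
  Subgroup.closure {x | ∃ i : ℕ, 1 ≤ i ∧ i ≤ min m (n - 1) ∧ x = hgen n i}

/-- `U_m`: the subgroup of `H_n` generated by the `h_i` with `max m 1 ≤ i ≤ n-1`. -/
def Usub (n m : ℕ) : Subgroup (Hgrp n) :=
  Subgroup.closure {x | ∃ i : ℕ, max m 1 ≤ i ∧ i ≤ n - 1 ∧ x = hgen n i}

theorem hgen_mem_Lsub (n m i : ℕ) (h : i ≤ m) : hgen n i ∈ Lsub n m := by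
  by_cases hi : 1 ≤ i ∧ i ≤ n - 1
  · exact Subgroup.subset_closure ⟨i, hi.1, le_min h hi.2, rfl⟩
  · unfold hgen
    rw [dif_neg hi]
    exact one_mem _

theorem listprod_mem_Lsub (n m : ℕ) (l : List ℕ) (h : ∀ i ∈ l, i ≤ m) :
    (l.map (hgen n)).prod ∈ Lsub n m := by
  apply Subgroup.list_prod_mem
  intro x hx
  obtain ⟨i, hi, rfl⟩ := List.mem_map.1 hx
  exact hgen_mem_Lsub n m i (h i hi)

theorem hgen_commute (n i j : ℕ) (h : i + 1 < j) : Commute (hgen n i) (hgen n j) := by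
  unfold hgen
  split_ifs with hi hj
  · have hr := PresentedGroup.one_of_mem (rels := RaagRels (n - 1))
      (x := FreeGroup.of (⟨i - 1, by omega⟩ : Fin (n - 1)) * FreeGroup.of ⟨j - 1, by omega⟩ *
        (FreeGroup.of ⟨i - 1, by omega⟩)⁻¹ * (FreeGroup.of ⟨j - 1, by omega⟩)⁻¹)
      ⟨⟨i - 1, by omega⟩, ⟨j - 1, by omega⟩, by simp only; omega, rfl⟩
    simp only [map_mul, map_inv] at hr
    rw [mul_inv_eq_one, mul_inv_eq_iff_eq_mul] at hr
    exact hr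
  · exact Commute.one_right _
  · exact Commute.one_left _
  · exact Commute.one_left _

theorem Lsub_commute (n m : ℕ) (l : List ℕ) (h : ∀ i ∈ l, m + 2 ≤ i) (g : Hgrp n)
    (hg : g ∈ Lsub n m) : Commute g (l.map (hgen n)).prod := by
  apply Commute.list_prod_right
  intro x hx
  obtain ⟨j, hj, rfl⟩ := List.mem_map.1 hx
  have hj := h j hj
  unfold Lsub at hg
  induction hg using Subgroup.closure_induction with
  | mem x hx =>
    obtain ⟨i, _, hi, rfl⟩ := hx
    exact hgen_commute n i j (by have := le_min_iff.1 hi; omega)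
  | one => exact Commute.one_left _
  | mul a b _ _ ha hb => exact ha.mul_left hb
  | inv a _ ha => exact ha.inv_left

theorem Lsub_mono (n : ℕ) {a b : ℕ} (h : a ≤ b) : Lsub n a ≤ Lsub n b := by
  apply Subgroup.closure_mono
  rintro x ⟨i, h1, h2, rfl⟩
  exact ⟨i, h1, by omega, rfl⟩

theorem Oprod_mem (n a b m : ℕ) (h : b ≤ m) : Oprod n a b ∈ Lsub n m := by
  apply listprod_mem_Lsub
  intro i hi
  obtain ⟨k, hk, rfl⟩ := List.mem_range'.1 hi
  omega

theorem Eprod_mem (n a b m : ℕ) (h : b ≤ m) : Eprod n a b ∈ Lsub n m :=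
  Oprod_mem n a b m h

theorem Aprod_mem (n a b m : ℕ) (h : b ≤ m) : Aprod n a b ∈ Lsub n m := by
  apply listprod_mem_Lsub
  intro i hi
  obtain ⟨k, hk, rfl⟩ := List.mem_range'.1 hi
  omega

theorem Ggen_mem (n p x : ℕ) (h1 : 1 ≤ x) : Ggen n p x ∈ Lsub n x := by
  unfold Ggen
  split_ifs with h h' h''
  · exact hgen_mem_Lsub _ _ _ h1
  · exact mul_mem (Oprod_mem _ _ _ _ (by omega)) (Eprod_mem _ _ _ _ (by omega))
  · exact mul_mem (Oprod_mem _ _ _ _ (by omega)) (Eprod_mem _ _ _ _ (by omega))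
  · exact mul_mem (mul_mem (Oprod_mem _ _ _ _ (by omega)) (Eprod_mem _ _ _ _ (by omega)))
      (Aprod_mem _ _ _ _ (by omega))

theorem Aprod_split (n a m b : ℕ) (h1 : a ≤ m + 2) (h2 : m + 1 ≤ b) :
    Aprod n a b = Aprod n a (m + 1) * Aprod n (m + 2) b := by
  unfold Aprod
  rw [← List.prod_append, ← List.map_append]
  have := List.range'_append (s := a) (m := m + 1 + 1 - a) (n := b + 1 - (m + 2)) (step := 1)
  rw [show a + 1 * (m + 1 + 1 - a) = m + 2 by omega] at this
  rw [this]
  congr 3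
  omega

theorem conj_step (p n m : ℕ) (hn : 2 * (n - p) + 5 ≤ n) (hm : 2 * (n - p) ≤ m) (g : Hgrp n)
    (hg : g ∈ Lsub n m) :
    Ggen n p (n - 1) * g * (Ggen n p (n - 1))⁻¹ ∈ Lsub n (m + 1) := by
  have hg' := Lsub_mono n (Nat.le_succ m) hg
  by_cases hmn : n - 1 ≤ m + 1
  · have := Lsub_mono n hmn (Ggen_mem n p (n - 1) (by omega))
    exact mul_mem (mul_mem this hg') (inv_mem this)
  · have hG : Ggen n p (n - 1) = (Oprod n 3 (2 * (n - p) + 1) * Eprod n 2 (2 * (n - p)) *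
        Aprod n (2 * (n - p) + 2) (m + 1)) * Aprod n (m + 2) (n - 1) := by
      unfold Ggen
      rw [if_neg (by omega), if_neg (by omega),
        Aprod_split n (2 * (n - p) + 2) m (n - 1) (by omega) (by omega)]
      simp only [mul_assoc]
    have hc : Commute g (Aprod n (m + 2) (n - 1)) := by
      apply Lsub_commute n m _ _ g hg
      intro i hi
      obtain ⟨k, hk, rfl⟩ := List.mem_range'.1 hi
      omega
    have hu : Oprod n 3 (2 * (n - p) + 1) * Eprod n 2 (2 * (n - p)) *
        Aprod n (2 * (n - p) + 2) (m + 1) ∈ Lsub n (m + 1) :=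
      mul_mem (mul_mem (Oprod_mem _ _ _ _ (by omega)) (Eprod_mem _ _ _ _ (by omega)))
        (Aprod_mem _ _ _ _ (by omega))
    rw [hG]
    generalize Oprod n 3 (2 * (n - p) + 1) * Eprod n 2 (2 * (n - p)) *
        Aprod n (2 * (n - p) + 2) (m + 1) = u at hu
    generalize Aprod n (m + 2) (n - 1) = v at hc
    have : u * v * g * (u * v)⁻¹ = u * g * u⁻¹ := by
      rw [mul_assoc u v g, ← hc.eq]
      group
    rw [this]
    exact mul_mem (mul_mem hu hg') (inv_mem hu)

/-- Lemma 6.6, item 3 (generic form):  for `p ≤ n ≤ 2p - 5`, `x` with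
`2φ ≤ x ≤ n - 1`, `x ≥ 1`, and every `y ≥ 0`, the element
`G_{n-1}^y G_x G_{n-1}^{-y}` lies in the subgroup `L_{x+y}` of `H_n`. -/
theorem stmt_14 (p n : ℕ) (hpn : p ≤ n) (hn : n ≤ 2 * p - 5)
    (x y : ℕ) (hx0 : 2 * (n - p) ≤ x) (hx1 : 1 ≤ x) (hx2 : x ≤ n - 1) :
    Ggen n p (n - 1) ^ y * Ggen n p x * (Ggen n p (n - 1) ^ y)⁻¹ ∈ Lsub n (x + y) := by
  induction y with
  | zero => simpa using Ggen_mem n p x hx1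
  | succ y ih =>
    have := conj_step p n (x + y) (by omega) (by omega) _ ih
    rw [← add_assoc, pow_succ', mul_inv_rev]
    simpa only [mul_assoc] using this
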